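/- arXiv:1612.05392 — 2 statements merged into one kernel-verified Lean document; each statement's English description precedes it below -/
import Mathlib

section
/- Let X be a separable Hilbert space with X = Y ⊕ Z as in the setup, and let φ ∈ C¹(X, ℝ) be an even functional with ∇φ weakly sequentially continuous satisfying, for some k ∈ ℕ, ρ_k > r_k > 0 and δ > 0: d_k := sup{φ(u) : u ∈ Y_k, ‖u‖ ≤ ρ_k} < ∞, a_k := sup{φ(u) : u ∈ Y_k, ‖u‖ = ρ_k} < inf{φ(u) : u ∈ Z_k, ‖u‖ ≤ r_k}, and b_k := inf{φ(u) : u ∈ Z_k, ‖u‖ = r_k} > sup{φ(u) : ‖u‖_τ < δ}. Set E = {u ∈ X : φ(u) ≤ d_k + 1 and ‖u‖_τ ≥ δ/2}. If ε ∈ (0, 1/2) satisfies 0 < ε < b_k − max{a_k, sup{φ(u) : ‖u‖_τ < δ}} and ‖φ'(u)‖ > ε for all u ∈ E, then there exist T > 0 and a continuous map η : [0,T] × B_k → X such that: (i) η(0,u) = u and η(t,−u) = −η(t,u) for all u ∈ B_k, t ∈ [0,T]; (ii) t ↦ φ(η(t,u)) is non-increasing on [0,T] for each fixed u ∈ B_k;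 (iii) η is τ-continuous (η(t_m,u_m) → η(t,u) in the τ-topology whenever t_m → t and u_m → u in the τ-topology) and η(t,·) : B_k → η(t,B_k) is a τ-homeomorphism for every t ∈ [0,T]; (iv) φ(η(T,u)) ≤ b_k − ε for all u ∈ B_k; (v) for every (t,u) ∈ [0,T] × B_k there is a neighborhood W_{(t,u)} of (t,u) in the |·| × τ-topology such that {v − η(s,v) : (s,v) ∈ W_{(t,u)} ∩ ([0,T] × B_k)} is contained in a finite-dimensional subspace of X. -/
open Filter Topology Metric Set
open scoped RealInnerProductSpace

noncomputable section

/-- The setup of the fountain theorem: a separable Hilbert space `X = Y ⊕ Z`,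
where `Y` is a closed subspace with orthonormal (topological) basis `e`,
`Z = Yᗮ` has orthonormal (topological) basis `f`, and `P`, `Q` are the
orthogonal projections onto `Y` and `Z` respectively. -/
structure FountainSetup (X : Type*) [NormedAddCommGroup X] [InnerProductSpace ℝ X]
    [CompleteSpace X] : Type _ where
  separable : TopologicalSpace.SeparableSpace X
  Y : Submodule ℝ X
  closedY : IsClosed (Y : Set X)
  e : ℕ → X
  f : ℕ → X
  orth_e : Orthonormal ℝ e
  orth_f : Orthonormal ℝ f
  e_mem : ∀ j, e j ∈ Y
  f_mem : ∀ j, f j ∈ Yᗮ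
  span_e : (Submodule.span ℝ (Set.range e)).topologicalClosure = Y
  span_f : (Submodule.span ℝ (Set.range f)).topologicalClosure = Yᗮ
  P : X →L[ℝ] X
  Q : X →L[ℝ] X
  P_mem : ∀ u, P u ∈ Y
  Q_mem : ∀ u, Q u ∈ Yᗮ
  P_add_Q : ∀ u, P u + Q u = u

namespace FountainSetup

variable {X : Type*} [NormedAddCommGroup X] [InnerProductSpace ℝ X] [CompleteSpace X]
variable (S : FountainSetup X)

/-- `Y_k = Y ⊕ (⊕_{j=0}^{k} ℝ f_j)`. -/
def Yk (k : ℕ) : Submodule ℝ X := S.Y ⊔ Submodule.span ℝ (S.f '' {j | j ≤ k})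

/-- `Z_k` = closure of `⊕_{j=k}^{∞} ℝ f_j`. -/
def Zk (k : ℕ) : Submodule ℝ X :=
  (Submodule.span ℝ (S.f '' {j | k ≤ j})).topologicalClosure

/-- The τ-norm `‖u‖_τ = max { Σ_j 2^{-(j+1)} |⟨Pu, e_j⟩| , ‖Qu‖ }`. -/
def tauNorm (u : X) : ℝ :=
  max (∑' j : ℕ, (1 / 2 : ℝ) ^ (j + 1) * |⟪S.P u, S.e j⟫|) ‖S.Q u‖

/-- Convergence of a sequence in the τ-topology (which is induced by the norm `tauNorm`,
hence metrizable, so sequential convergence describes it completely). -/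
def TauTendsto (u : ℕ → X) (v : X) : Prop :=
  Tendsto (fun n => S.tauNorm (u n - v)) atTop (𝓝 0)

end FountainSetup

/-- Weak convergence of a sequence in a Hilbert space. -/
def WeakConv {X : Type*} [NormedAddCommGroup X] [InnerProductSpace ℝ X]
    (u : ℕ → X) (v : X) : Prop :=
  ∀ w : X, Tendsto (fun n => ⟪u n, w⟫) atTop (𝓝 ⟪v, w⟫)

/-- `∇φ` is weakly sequentially continuous: `φ'(u_n) v → φ'(u) v` for all `v`
whenever `u_n ⇀ u` weakly. -/
def WeaklySeqContDeriv {X : Type*} [NormedAddCommGroup X] [InnerProductSpace ℝ X]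
    (φ' : X → X →L[ℝ] ℝ) : Prop :=
  ∀ (u : ℕ → X) (v : X), WeakConv u v →
    ∀ w : X, Tendsto (fun n => φ' (u n) w) atTop (𝓝 (φ' v w))

/-- The ball `B_k = {u ∈ Y_k : ‖u‖ < ρ_k}`. -/
def FountainSetup.Bk {X : Type*} [NormedAddCommGroup X] [InnerProductSpace ℝ X]
    [CompleteSpace X] (S : FountainSetup X) (k : ℕ) (ρ : ℝ) : Set X :=
  {u : X | u ∈ S.Yk k ∧ ‖u‖ < ρ}

section Euler

variable {X : Type*} [NormedAddCommGroup X] [NormedSpace ℝ X]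

/-- Sequential compactness of a set with respect to a seminorm. -/
def Seminorm.IsSeqCompactSet (p : Seminorm ℝ X) (K : Set X) : Prop :=
  ∀ u : ℕ → X, (∀ n, u n ∈ K) → ∃ a ∈ K, ∃ ψ : ℕ → ℕ, StrictMono ψ ∧
    Tendsto (fun n => p (u (ψ n) - a)) atTop (𝓝 0)

lemma IsSeqCompact.exists_finset_cover {M : Type*} [PseudoMetricSpace M] {K : Set M}
    (hK : IsSeqCompact K) (r : M → ℝ) (hr : ∀ y ∈ K, 0 < r y) :
    ∃ t : Finset M, (∀ y ∈ t, y ∈ K) ∧ ∀ y ∈ K, ∃ z ∈ t, dist y z < r z := by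
  obtain ⟨t, ht, hcov⟩ := hK.isCompact.elim_nhds_subcover (fun y => Metric.ball y (r y))
    (fun y hy => Metric.ball_mem_nhds y (hr y hy))
  refine ⟨t, ht, fun y hy => ?_⟩
  simpa using hcov hy

lemma Seminorm.IsSeqCompactSet.exists_finset_cover {p : Seminorm ℝ X} {K : Set X}
    (hK : p.IsSeqCompactSet K) (r : X → ℝ) (hr : ∀ y ∈ K, 0 < r y) :
    ∃ t : Finset X, (∀ y ∈ t, y ∈ K) ∧ ∀ y ∈ K, ∃ z ∈ t, p (y - z) < r z := by
  let I : PseudoMetricSpace X :=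
    (AddGroupSeminorm.toSeminormedAddCommGroup p.toAddGroupSeminorm).toPseudoMetricSpace
  have hdist : ∀ x y : X, @dist X I.toDist x y = p (x - y) := fun x y => by
    rw [← map_neg_eq_map p (x - y)]
    change p (-x + y) = _
    congr 1; abel
  have hseq : @IsSeqCompact X I.toUniformSpace.toTopologicalSpace K := by
    intro u hu
    obtain ⟨a, ha, ψ, hψ, hlim⟩ := hK u hu
    refine ⟨a, ha, ψ, hψ, ?_⟩
    rw [@tendsto_iff_dist_tendsto_zero]
    simpa only [Function.comp_apply, hdist] using hlim
  simpa only [hdist] using @IsSeqCompact.exists_finset_cover X I K hseq r hr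

/-- The tent function of height `2 * r` around `y` for the seminorm `p`. -/
def Seminorm.tent (p : Seminorm ℝ X) (r : ℝ) (y u : X) : ℝ := max 0 (2 * r - p (u - y))

lemma Seminorm.tent_nonneg (p : Seminorm ℝ X) (r : ℝ) (y u : X) : 0 ≤ p.tent r y u :=
  le_max_left _ _

lemma Seminorm.tent_eq_zero {p : Seminorm ℝ X} {r : ℝ} {y u : X} (h : 2 * r ≤ p (u - y)) :
    p.tent r y u = 0 :=
  max_eq_left (by linarith)

lemma Seminorm.abs_tent_sub_le (p : Seminorm ℝ X) (r : ℝ) (y u v : X) :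
    |p.tent r y u - p.tent r y v| ≤ p (u - v) := by
  have h1 : p (u - y) ≤ p (u - v) + p (v - y) := by
    simpa using map_add_le_add p (u - v) (v - y)
  have h2 : p (v - y) ≤ p (u - v) + p (u - y) := by
    have := map_add_le_add p (v - u) (u - y)
    rw [map_sub_rev p v u] at this
    simpa using this
  have h3 := apply_nonneg p (u - v)
  unfold Seminorm.tent
  rcases max_cases 0 (2 * r - p (u - y)) with h | h <;>
  rcases max_cases 0 (2 * r - p (v - y)) with h' | h' <;>
  rw [abs_le] <;> constructor <;> linarith

/-- The sum of the vectors `w y`, `y ∈ t`, weighted by tent functions and divided by the total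
weight, which is truncated below at `m`. -/
def Seminorm.tentField (p : Seminorm ℝ X) (t : Finset X) (r : X → ℝ) (w : X → X) (m : ℝ)
    (u : X) : X :=
  (max (∑ y ∈ t, p.tent (r y) y u) m)⁻¹ • ∑ y ∈ t, p.tent (r y) y u • w y

variable {p : Seminorm ℝ X} {t : Finset X} {r : X → ℝ} {w : X → X} {m : ℝ}

lemma Seminorm.norm_tent_sum_le (hw : ∀ y ∈ t, ‖w y‖ ≤ 1) (u : X) :
    ‖∑ y ∈ t, p.tent (r y) y u • w y‖ ≤ ∑ y ∈ t, p.tent (r y) y u := by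
  refine (norm_sum_le _ _).trans (Finset.sum_le_sum fun y hy => ?_)
  rw [norm_smul, Real.norm_of_nonneg (p.tent_nonneg _ _ _)]
  exact mul_le_of_le_one_right (p.tent_nonneg _ _ _) (hw y hy)

lemma Seminorm.norm_tentField_le (hm : 0 < m) (hw : ∀ y ∈ t, ‖w y‖ ≤ 1) (u : X) :
    ‖p.tentField t r w m u‖ ≤ 1 := by
  have hpos : 0 < max (∑ y ∈ t, p.tent (r y) y u) m := lt_max_of_lt_right hm
  rw [Seminorm.tentField, norm_smul, norm_inv, Real.norm_of_nonneg hpos.le,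
    inv_mul_le_one₀ hpos]
  exact (norm_tent_sum_le hw u).trans (le_max_left _ _)

lemma Seminorm.norm_tentField_sub_le (hm : 0 < m) (hw : ∀ y ∈ t, ‖w y‖ ≤ 1) (u v : X) :
    ‖p.tentField t r w m u - p.tentField t r w m v‖ ≤ (2 * t.card / m) * p (u - v) := by
  set σ : X → ℝ := fun u => ∑ y ∈ t, p.tent (r y) y u with hσ
  set N : X → X := fun u => ∑ y ∈ t, p.tent (r y) y u • w y with hN
  set μ : X → ℝ := fun u => max (σ u) m with hμ
  have hμm : ∀ u, m ≤ μ u := fun u => le_max_right _ _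
  have hμpos : ∀ u, 0 < μ u := fun u => hm.trans_le (hμm u)
  have hNd : ‖N u - N v‖ ≤ t.card * p (u - v) := by
    rw [hN, ← Finset.sum_sub_distrib, ← nsmul_eq_mul]
    refine (norm_sum_le _ _).trans (Finset.sum_le_card_nsmul _ _ _ fun y hy => ?_)
    rw [← sub_smul, norm_smul, Real.norm_eq_abs]
    exact (mul_le_of_le_one_right (abs_nonneg _) (hw y hy)).trans (p.abs_tent_sub_le _ _ _ _)
  have hμd : |μ u - μ v| ≤ t.card * p (u - v) := by
    refine (abs_max_sub_max_le_abs _ _ _).trans ?_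
    rw [hσ, ← Finset.sum_sub_distrib, ← nsmul_eq_mul]
    exact (Finset.abs_sum_le_sum_abs _ _).trans
      (Finset.sum_le_card_nsmul _ _ _ fun y _ => p.abs_tent_sub_le _ _ _ _)
  have hNv : ‖N v‖ ≤ μ v := (norm_tent_sum_le hw v).trans (le_max_left _ _)
  have key : p.tentField t r w m u - p.tentField t r w m v
      = (μ u)⁻¹ • (N u - N v) + ((μ u)⁻¹ * (μ v - μ u) * (μ v)⁻¹) • N v := by
    have : (μ u)⁻¹ * (μ v - μ u) * (μ v)⁻¹ = (μ u)⁻¹ - (μ v)⁻¹ := by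
      have := (hμpos u).ne'
      have := (hμpos v).ne'
      field_simp
    rw [this, smul_sub, sub_smul]
    change (μ u)⁻¹ • N u - (μ v)⁻¹ • N v = _
    abel
  have hinv : (μ u)⁻¹ ≤ m⁻¹ := inv_anti₀ hm (hμm u)
  have e1 : ‖(μ u)⁻¹ • (N u - N v)‖ ≤ m⁻¹ * (t.card * p (u - v)) := by
    rw [norm_smul, norm_inv, Real.norm_of_nonneg (hμpos u).le]
    exact mul_le_mul hinv hNd (norm_nonneg _) (inv_nonneg.2 hm.le)
  have e2 : ‖((μ u)⁻¹ * (μ v - μ u) * (μ v)⁻¹) • N v‖ ≤ m⁻¹ * (t.card * p (u - v)) := by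
    rw [norm_smul, norm_mul, norm_mul, norm_inv, norm_inv, Real.norm_of_nonneg (hμpos u).le,
      Real.norm_of_nonneg (hμpos v).le, Real.norm_eq_abs, abs_sub_comm, mul_assoc]
    have h1 : (μ v)⁻¹ * ‖N v‖ ≤ 1 := (inv_mul_le_one₀ (hμpos v)).2 hNv
    calc (μ u)⁻¹ * |μ u - μ v| * ((μ v)⁻¹ * ‖N v‖)
        ≤ (μ u)⁻¹ * |μ u - μ v| :=
          mul_le_of_le_one_right (mul_nonneg (inv_nonneg.2 (hμpos u).le) (abs_nonneg _)) h1
      _ ≤ _ := mul_le_mul hinv hμd (abs_nonneg _) (inv_nonneg.2 hm.le)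
  rw [key]
  refine (norm_add_le _ _).trans ((add_le_add e1 e2).trans_eq ?_)
  field_simp; ring

lemma Seminorm.tentField_mem_span (p : Seminorm ℝ X) (u : X) :
    p.tentField t r w m u ∈ Submodule.span ℝ (w '' (t : Set X)) :=
  Submodule.smul_mem _ _ <| Submodule.sum_mem _ fun y hy =>
    Submodule.smul_mem _ _ (Submodule.subset_span ⟨y, hy, rfl⟩)

lemma Seminorm.le_apply_tentField (hm : 0 < m) {u : X} (hu : m ≤ ∑ y ∈ t, p.tent (r y) y u)
    (ℓ : X →L[ℝ] ℝ) {c : ℝ} (hℓ : ∀ y ∈ t, p (u - y) < 2 * r y → c ≤ ℓ (w y)) :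
    c ≤ ℓ (p.tentField t r w m u) := by
  rw [Seminorm.tentField, map_smul, max_eq_left hu, map_sum, smul_eq_mul,
    le_inv_mul_iff₀ (hm.trans_le hu), Finset.sum_mul]
  refine Finset.sum_le_sum fun y hy => ?_
  rw [map_smul, smul_eq_mul]
  by_cases h : p (u - y) < 2 * r y
  · exact mul_le_mul_of_nonneg_left (hℓ y hy h) (p.tent_nonneg _ _ _)
  · simp [p.tent_eq_zero (not_lt.1 h)]

/-- `f` is an odd field of finite rank, Lipschitz from `p` to the norm, such that the Euler steps
`u ↦ u - t • f u`, `t ∈ [0, h]`, decrease a functional with derivative `φ'` at points of `S`, at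
rate at least `ε` outside the `p`-ball of radius `δ`. -/
structure IsEulerField (p : Seminorm ℝ X) (φ' : X → X →L[ℝ] ℝ) (ε δ : ℝ) (S : Set X)
    (f : X → X) (h : ℝ) : Prop where
  pos : 0 < h
  le_one : h ≤ 1
  odd : ∀ u, f (-u) = -f u
  norm_le : ∀ u, ‖f u‖ ≤ 1
  lip : ∃ L : ℝ, 0 ≤ L ∧ h * L ≤ 1 / 2 ∧ ∀ u v, ‖f u - f v‖ ≤ L * p (u - v)
  fin : ∃ F : Submodule ℝ X, FiniteDimensional ℝ F ∧ ∀ u, f u ∈ F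
  nonneg : ∀ u ∈ S, ∀ t ∈ Icc 0 h, 0 ≤ φ' (u - t • f u) (f u)
  drop : ∀ u ∈ S, δ ≤ p u → ∀ t ∈ Icc 0 h, ε ≤ φ' (u - t • f u) (f u)

lemma Finset.exists_pos_le_of_forall_pos {α : Type*} (t : Finset α) (r : α → ℝ)
    (hr : ∀ y ∈ t, 0 < r y) : ∃ c : ℝ, 0 < c ∧ c ≤ 1 ∧ ∀ y ∈ t, c ≤ r y := by
  classical
  induction t using Finset.induction_on with
  | empty => exact ⟨1, one_pos, le_rfl, by simp⟩
  | insert a s _ ih =>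
    obtain ⟨c, hc, hc1, hcs⟩ := ih fun y hy => hr y (Finset.mem_insert_of_mem hy)
    refine ⟨min c (r a), lt_min hc (hr a (Finset.mem_insert_self _ _)),
      (min_le_left _ _).trans hc1, fun y hy => ?_⟩
    rcases Finset.mem_insert.1 hy with rfl | hy
    · exact min_le_right _ _
    · exact (min_le_left _ _).trans (hcs y hy)

/-- Near a symmetric `p`-compact set on which the derivative is bounded below outside the
`p`-ball of radius `δ` there is a descent field. -/
lemma exists_isEulerField (hp : ∀ u, p u ≤ ‖u‖) {φ' : X → X →L[ℝ] ℝ}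
    (hodd : ∀ u, φ' (-u) = -φ' u) {ε δ R : ℝ} (hε : 0 < ε) {K : Set X}
    (hKc : p.IsSeqCompactSet K) (hKs : ∀ y ∈ K, -y ∈ K) (hKR : ∀ y ∈ K, ‖y‖ ≤ R)
    (hE : ∀ y ∈ K, δ ≤ p y → ε < ‖φ' y‖)
    (hτ : ∀ (R c : ℝ) (u w : X), c < φ' u w →
      ∃ r > 0, ∀ v, ‖v‖ ≤ R → p (v - u) < r → c < φ' v w) :
    ∃ (f : X → X) (h ρ : ℝ), 0 < ρ ∧ ∀ S : Set X, (∀ u ∈ S, ∃ y ∈ K, ‖u - y‖ ≤ ρ) →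
      IsEulerField p φ' ε δ S f h := by
  have hloc : ∀ y : X, ∃ r > 0, ∃ w : X, ‖w‖ ≤ 1 ∧ (y ∈ K →
      (∀ v, ‖v‖ ≤ R + 2 → p (v - y) < 3 * r → ε ≤ φ' v w) ∨
      (w = 0 ∧ ∀ v, p (v - y) < 3 * r → p v < δ)) := by
    intro y
    by_cases hy : y ∈ K
    · by_cases hd : δ ≤ p y
      · obtain ⟨w, hw1, hw⟩ : ∃ w : X, ‖w‖ ≤ 1 ∧ ε < φ' y w := by
          obtain ⟨w, hw1, hw⟩ := (φ' y).exists_lt_apply_of_lt_opNorm (hE y hy hd)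
          rcases le_total 0 (φ' y w) with h | h
          · exact ⟨w, hw1.le, by rwa [Real.norm_of_nonneg h] at hw⟩
          · exact ⟨-w, by simpa using hw1.le, by rwa [Real.norm_of_nonpos h, ← map_neg] at hw⟩
        obtain ⟨r, hr, hrw⟩ := hτ (R + 2) ε y w hw
        exact ⟨r / 3, by positivity, w, hw1, fun _ => Or.inl fun v hv hvy =>
          (hrw v hv (by linarith)).le⟩
      · refine ⟨(δ - p y) / 3, by linarith, 0, by simp, fun _ => Or.inr ⟨rfl, fun v hv => ?_⟩⟩
        have := map_add_le_add p (v - y) y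
        rw [sub_add_cancel] at this
        linarith
    · exact ⟨1, one_pos, 0, by simp, fun h => absurd h hy⟩
  choose r hr w hw1 hw using hloc
  obtain ⟨t, htK, hcov⟩ := hKc.exists_finset_cover r fun y _ => hr y
  obtain ⟨c, hc, hc1, hct⟩ := t.exists_pos_le_of_forall_pos r fun y _ => hr y
  have hm : 0 < c / 2 := by positivity
  set g : X → X := p.tentField t r w (c / 2) with hg
  have hw1' : ∀ y ∈ t, ‖w y‖ ≤ 1 := fun y _ => hw1 y
  set L : ℝ := 2 * t.card / (c / 2) with hL
  have hL0 : 0 ≤ L := by positivity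
  have hglip : ∀ u v, ‖g u - g v‖ ≤ L * p (u - v) := p.norm_tentField_sub_le hm hw1'
  have hg1 : ∀ u, ‖g u‖ ≤ 1 := p.norm_tentField_le hm hw1'
  set f : X → X := fun u => (1 / 2 : ℝ) • (g u - g (-u)) with hf
  have hf1 : ∀ u, ‖f u‖ ≤ 1 := fun u => by
    have := (norm_sub_le (g u) (g (-u))).trans (add_le_add (hg1 u) (hg1 (-u)))
    rw [hf, norm_smul]
    norm_num
    linarith
  have hfodd : ∀ u, f (-u) = -f u := fun u => by
    simp only [hf, neg_neg, ← smul_neg, neg_sub]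
  set h : ℝ := min c (1 / (2 * (L + 1))) with hh
  have hhpos : 0 < h := lt_min hc (by positivity)
  have hhc : h ≤ c := min_le_left _ _
  -- near `K` the total weight is at least `c / 2`
  have hweight : ∀ u, (∃ y ∈ K, ‖u - y‖ ≤ c / 2) →
      c / 2 ≤ ∑ y ∈ t, p.tent (r y) y u := by
    rintro u ⟨y, hy, huy⟩
    obtain ⟨z, hz, hyz⟩ := hcov y hy
    refine le_trans ?_ (Finset.single_le_sum (fun y _ => p.tent_nonneg (r y) y u) hz)
    refine le_trans ?_ (le_max_right _ _)
    have h1 : p (u - z) ≤ p (u - y) + p (y - z) := by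
      simpa using map_add_le_add p (u - y) (y - z)
    linarith [hp (u - y), hct z hz]
  have hnorm : ∀ u, (∃ y ∈ K, ‖u - y‖ ≤ c / 2) → ‖u‖ ≤ R + 1 := by
    rintro u ⟨y, hy, huy⟩
    have := norm_add_le (u - y) y
    rw [sub_add_cancel] at this
    linarith [hKR y hy]
  -- lower bounds for the derivative in the direction `g`
  have hbase : ∀ u v, (∃ y ∈ K, ‖u - y‖ ≤ c / 2) → ‖v - u‖ ≤ h →
      0 ≤ φ' v (g u) ∧ (δ ≤ p u → ε ≤ φ' v (g u)) := by
    intro u v hu hvu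
    have hv : ‖v‖ ≤ R + 2 := by
      have := norm_add_le (v - u) u
      rw [sub_add_cancel] at this
      linarith [hnorm u hu]
    have hvy : ∀ y ∈ t, p (u - y) < 2 * r y → p (v - y) < 3 * r y := fun y hy huy => by
      have h1 : p (v - y) ≤ p (v - u) + p (u - y) := by
        simpa using map_add_le_add p (v - u) (u - y)
      linarith [hp (v - u), hct y hy]
    have hwt := hweight u hu
    refine ⟨p.le_apply_tentField hm hwt _ fun y hy huy => ?_,
      fun hδ => p.le_apply_tentField hm hwt _ fun y hy huy => ?_⟩
    · rcases hw y (htK y hy) with H | ⟨H, -⟩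
      · exact hε.le.trans (H v hv (hvy y hy huy))
      · simp [H]
    · rcases hw y (htK y hy) with H | ⟨-, H⟩
      · exact H v hv (hvy y hy huy)
      · exact absurd hδ (not_le.2 (H u (by linarith [hr y])))
  have hneg : ∀ u, (∃ y ∈ K, ‖u - y‖ ≤ c / 2) → ∃ y ∈ K, ‖-u - y‖ ≤ c / 2 := by
    rintro u ⟨y, hy, huy⟩
    exact ⟨-y, hKs y hy, by rwa [neg_sub_neg, norm_sub_rev]⟩
  have hsplit : ∀ u v, φ' v (f u) = (φ' v (g u) + φ' (-v) (g (-u))) / 2 := fun u v => by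
    simp only [hf, map_smul, map_sub, hodd, smul_eq_mul, neg_apply]
    ring
  have hstep : ∀ u, ∀ s ∈ Icc 0 h, ‖(u - s • f u) - u‖ ≤ h := fun u s hs => by
    rw [sub_sub_cancel_left, norm_neg, norm_smul, Real.norm_of_nonneg hs.1]
    exact (mul_le_of_le_one_right hs.1 (hf1 u)).trans hs.2
  have hstep' : ∀ u, ∀ s ∈ Icc 0 h, ‖-(u - s • f u) - -u‖ ≤ h := fun u s hs => by
    rw [← neg_sub', norm_neg]
    exact hstep u s hs
  refine ⟨f, h, c / 2, hm, fun S hS => ⟨hhpos, hhc.trans hc1, hfodd, hf1,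
    ⟨L, hL0, ?_, fun u v => ?_⟩, ⟨Submodule.span ℝ (w '' (t : Set X)), ?_, fun u => ?_⟩,
    fun u hu s hs => ?_, fun u hu hδ s hs => ?_⟩⟩
  · have : h ≤ 1 / (2 * (L + 1)) := min_le_right _ _
    rw [le_div_iff₀ (by positivity)] at this
    nlinarith
  · have h1 := hglip u v
    have h2 := hglip (-u) (-v)
    rw [← neg_sub', map_neg_eq_map] at h2
    have : f u - f v = (1 / 2 : ℝ) • ((g u - g v) - (g (-u) - g (-v))) := by
      simp only [hf, ← smul_sub]; congr 1; abel
    rw [this, norm_smul]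
    have h3 := norm_sub_le (g u - g v) (g (-u) - g (-v))
    norm_num
    linarith
  · exact FiniteDimensional.span_of_finite ℝ (t.finite_toSet.image w)
  · exact Submodule.smul_mem _ _
      (Submodule.sub_mem _ (p.tentField_mem_span u) (p.tentField_mem_span (-u)))
  · rw [hsplit]
    have h1 := (hbase u _ (hS u hu) (hstep u s hs)).1
    have h2 := (hbase (-u) _ (hneg u (hS u hu)) (hstep' u s hs)).1
    linarith
  · rw [hsplit]
    have h1 := (hbase u _ (hS u hu) (hstep u s hs)).2 hδ
    have h2 := (hbase (-u) _ (hneg u (hS u hu)) (hstep' u s hs)).2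
      (by rwa [map_neg_eq_map])
    linarith

/-- `η` is an odd deformation on the time interval `[0, s]`, moving every point by a field of
finite rank with speed at most one, bi-Lipschitz for the seminorm `p`, along which `φ` decreases on
`K`, at average rate at least `ε` unless the `p`-ball of radius `δ` is visited. -/
structure IsDescent (p : Seminorm ℝ X) (φ : X → ℝ) (ε δ : ℝ) (K : Set X)
    (s : ℝ) (η : ℝ → X → X) : Prop where
  nonneg : 0 ≤ s
  zero : ∀ u, η 0 u = u
  odd : ∀ t ∈ Icc 0 s, ∀ u, η t (-u) = -η t u
  speed : ∀ t ∈ Icc 0 s, ∀ t' ∈ Icc 0 s, ∀ u, ‖η t u - η t' u‖ ≤ |t - t'|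
  lip : ∃ C : ℝ, 0 ≤ C ∧ ∀ t ∈ Icc 0 s, ∀ u v, ‖(η t u - u) - (η t v - v)‖ ≤ C * p (u - v)
  antilip : ∃ C : ℝ, 0 ≤ C ∧ ∀ t ∈ Icc 0 s, ∀ u v, p (u - v) ≤ C * p (η t u - η t v)
  fin : ∃ F : Submodule ℝ X, FiniteDimensional ℝ F ∧ ∀ t ∈ Icc 0 s, ∀ u, η t u - u ∈ F
  anti : ∀ u ∈ K, AntitoneOn (fun t => φ (η t u)) (Icc 0 s)
  drop : ∀ u ∈ K, φ (η s u) ≤ φ u - ε * s ∨ ∃ t ∈ Icc 0 s, p (η t u) < δ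

lemma isDescent_id (p : Seminorm ℝ X) (φ : X → ℝ) (ε δ : ℝ) (K : Set X) :
    IsDescent p φ ε δ K 0 (fun _ u => u) where
  nonneg := le_rfl
  zero _ := rfl
  odd _ _ _ := rfl
  speed _ _ _ _ _ := by simp
  lip := ⟨0, le_rfl, fun _ _ _ _ => by simp⟩
  antilip := ⟨1, zero_le_one, fun _ _ _ _ => by simp⟩
  fin := ⟨⊥, inferInstance, fun _ _ _ => by simp⟩
  anti _ _ _ _ _ _ _ := le_rfl
  drop _ _ := Or.inl (by simp)

lemma hasDerivAt_comp_euler {φ : X → ℝ} {φ' : X → X →L[ℝ] ℝ}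
    (hφ : ∀ u, HasFDerivAt φ (φ' u) u) (u v : X) (t : ℝ) :
    HasDerivAt (fun t : ℝ => φ (u - t • v)) (-(φ' (u - t • v) v)) t := by
  have h : HasDerivAt (fun t : ℝ => u - t • v) (-v) t := by
    simpa using ((hasDerivAt_id t).smul_const v).const_sub u
  rw [← map_neg]
  exact (hφ (u - t • v)).comp_hasDerivAt t h

/-- If the derivative of `φ` in the direction `v` is at least `c` along the segment from `u` to
`u - h • v`, then `φ` decreases along it at rate at least `c`. -/
lemma antitoneOn_comp_euler {φ : X → ℝ} {φ' : X → X →L[ℝ] ℝ}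
    (hφ : ∀ u, HasFDerivAt φ (φ' u) u) {u v : X} {h c : ℝ}
    (hc : ∀ t ∈ Icc 0 h, c ≤ φ' (u - t • v) v) :
    AntitoneOn (fun t : ℝ => φ (u - t • v) + c * t) (Icc 0 h) := by
  have hd : ∀ t : ℝ, HasDerivAt (fun t : ℝ => φ (u - t • v) + c * t)
      (-(φ' (u - t • v) v) + c) t := fun t => by
    have h1 : HasDerivAt (fun t : ℝ => c * t) c t := by
      simpa using (hasDerivAt_id t).const_mul c
    exact (hasDerivAt_comp_euler hφ u v t).add h1
  refine antitoneOn_of_deriv_nonpos (convex_Icc 0 h)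
    (fun t _ => (hd t).continuousAt.continuousWithinAt)
    (fun t _ => (hd t).differentiableAt.differentiableWithinAt) fun t ht => ?_
  rw [(hd t).deriv]
  linarith [hc t (interior_subset ht)]

/-- The deformation `η` up to time `s`, followed by an Euler step for the field `f`. -/
def eulerExtend (s : ℝ) (η : ℝ → X → X) (f : X → X) (t : ℝ) (u : X) : X :=
  η (min t s) u - max (t - s) 0 • f (η s u)

lemma eulerExtend_of_le {s t : ℝ} (η : ℝ → X → X) (f : X → X) (h : t ≤ s) (u : X) :
    eulerExtend s η f t u = η t u := by
  simp [eulerExtend, min_eq_left h, max_eq_right (sub_nonpos.2 h)]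

lemma eulerExtend_of_ge {s t : ℝ} (η : ℝ → X → X) (f : X → X) (h : s ≤ t) (u : X) :
    eulerExtend s η f t u = η s u - (t - s) • f (η s u) := by
  simp [eulerExtend, min_eq_right h, max_eq_left (sub_nonneg.2 h)]

lemma IsDescent.extend {φ : X → ℝ} {φ' : X → X →L[ℝ] ℝ}
    (hφ : ∀ u, HasFDerivAt φ (φ' u) u) (hp : ∀ u, p u ≤ ‖u‖) {ε δ : ℝ} {K : Set X} {s : ℝ}
    {η : ℝ → X → X} (H : IsDescent p φ ε δ K s η) {f : X → X} {h : ℝ}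
    (Hf : IsEulerField p φ' ε δ (η s '' K) f h) :
    IsDescent p φ ε δ K (s + h) (eulerExtend s η f) := by
  have hs := H.nonneg
  have hh := Hf.pos
  have hss : s ∈ Icc 0 s := ⟨hs, le_rfl⟩
  have hmin : ∀ t ∈ Icc 0 (s + h), min t s ∈ Icc 0 s := fun t ht =>
    ⟨le_min ht.1 hs, min_le_right _ _⟩
  have hmax : ∀ t ∈ Icc 0 (s + h), max (t - s) 0 ∈ Icc 0 h := fun t ht =>
    ⟨le_max_right _ _, max_le (by linarith [ht.2]) hh.le⟩
  obtain ⟨L, hL, hhL, hfl⟩ := Hf.lip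
  obtain ⟨C, hC, hCl⟩ := H.lip
  obtain ⟨D, hD, hDl⟩ := H.antilip
  obtain ⟨F, hF, hFm⟩ := H.fin
  obtain ⟨G, hG, hGm⟩ := Hf.fin
  have hτL : ∀ τ ∈ Icc 0 h, ∀ a b, ‖τ • (f a - f b)‖ ≤ 1 / 2 * p (a - b) := fun τ hτ a b => by
    rw [norm_smul, Real.norm_of_nonneg hτ.1]
    calc τ * ‖f a - f b‖ ≤ h * (L * p (a - b)) :=
          mul_le_mul hτ.2 (hfl a b) (norm_nonneg _) hh.le
      _ = h * L * p (a - b) := by ring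
      _ ≤ _ := mul_le_mul_of_nonneg_right hhL (apply_nonneg _ _)
  have hpη : ∀ u v, p (η s u - η s v) ≤ (1 + C) * p (u - v) := fun u v => by
    have h1 := map_add_le_add p ((η s u - u) - (η s v - v)) (u - v)
    rw [show (η s u - u) - (η s v - v) + (u - v) = η s u - η s v by abel] at h1
    linarith [hp ((η s u - u) - (η s v - v)), hCl s hss u v]
  have hanti : ∀ u ∈ K, AntitoneOn (fun t => φ (eulerExtend s η f t u)) (Icc 0 (s + h)) := by
    intro u hu
    have hA : AntitoneOn (fun t => φ (η s u - t • f (η s u))) (Icc 0 h) := by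
      simpa using antitoneOn_comp_euler (c := 0) hφ (Hf.nonneg _ (mem_image_of_mem _ hu))
    have h1 : ∀ a ∈ Icc 0 (s + h), ∀ b ∈ Icc 0 (s + h), a ≤ b → b ≤ s →
        φ (eulerExtend s η f b u) ≤ φ (eulerExtend s η f a u) := fun a ha b hb hab hbs => by
      rw [eulerExtend_of_le η f hbs, eulerExtend_of_le η f (hab.trans hbs)]
      exact H.anti u hu ⟨ha.1, hab.trans hbs⟩ ⟨hb.1, hbs⟩ hab
    have h2 : ∀ a ∈ Icc 0 (s + h), ∀ b ∈ Icc 0 (s + h), a ≤ b → s ≤ a →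
        φ (eulerExtend s η f b u) ≤ φ (eulerExtend s η f a u) := fun a ha b hb hab has => by
      rw [eulerExtend_of_ge η f has, eulerExtend_of_ge η f (has.trans hab)]
      exact hA ⟨by linarith, by linarith [ha.2]⟩ ⟨by linarith, by linarith [hb.2]⟩ (by linarith)
    intro a ha b hb hab
    have hsm : s ∈ Icc 0 (s + h) := ⟨hs, by linarith⟩
    rcases le_total b s with hbs | hbs
    · exact h1 a ha b hb hab hbs
    · rcases le_total s a with has | has
      · exact h2 a ha b hb hab has
      · exact (h2 s hsm b hb hbs le_rfl).trans (h1 a ha s hsm has le_rfl)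
  refine ⟨by linarith, fun u => ?_, fun t ht u => ?_, fun t ht t' ht' u => ?_,
    ⟨C + 1 / 2 * (1 + C), by positivity, fun t ht u v => ?_⟩,
    ⟨2 * D, by positivity, fun t ht u v => ?_⟩,
    ⟨F ⊔ G, inferInstance, fun t ht u => ?_⟩, hanti, fun u hu => ?_⟩
  · rw [eulerExtend_of_le η f hs, H.zero]
  · simp only [eulerExtend, H.odd _ (hmin t ht), H.odd s hss, Hf.odd, smul_neg]
    abel
  · have h1 := H.speed _ (hmin t ht) _ (hmin t' ht') u
    have h2 : ‖(max (t - s) 0 - max (t' - s) 0) • f (η s u)‖ ≤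
        |max (t - s) 0 - max (t' - s) 0| := by
      rw [norm_smul]
      exact mul_le_of_le_one_right (norm_nonneg _) (Hf.norm_le _)
    have h3 : |min t s - min t' s| + |max (t - s) 0 - max (t' - s) 0| = |t - t'| := by
      have e : ∀ a : ℝ, min a s + max (a - s) 0 = a := fun a => by
        rcases le_total a s with h | h <;> simp [h]
      rcases le_total t t' with c | c
      · rw [abs_of_nonpos (sub_nonpos.2 c), abs_of_nonpos (sub_nonpos.2 (min_le_min_right s c)),
          abs_of_nonpos (sub_nonpos.2 (max_le_max_right 0 (sub_le_sub_right c s)))]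
        linarith [e t, e t']
      · rw [abs_of_nonneg (sub_nonneg.2 c), abs_of_nonneg (sub_nonneg.2 (min_le_min_right s c)),
          abs_of_nonneg (sub_nonneg.2 (max_le_max_right 0 (sub_le_sub_right c s)))]
        linarith [e t, e t']
    have h4 : eulerExtend s η f t u - eulerExtend s η f t' u
        = (η (min t s) u - η (min t' s) u)
          - (max (t - s) 0 - max (t' - s) 0) • f (η s u) := by
      rw [eulerExtend, eulerExtend, sub_smul]; abel
    rw [h4]
    linarith [norm_sub_le (η (min t s) u - η (min t' s) u)
      ((max (t - s) 0 - max (t' - s) 0) • f (η s u))]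
  · have h1 := hCl _ (hmin t ht) u v
    have h2 := hτL _ (hmax t ht) (η s u) (η s v)
    have h3 := hpη u v
    have h4 : (eulerExtend s η f t u - u) - (eulerExtend s η f t v - v)
        = ((η (min t s) u - u) - (η (min t s) v - v))
          - max (t - s) 0 • (f (η s u) - f (η s v)) := by
      rw [eulerExtend, eulerExtend, smul_sub]; abel
    rw [h4]
    refine (norm_sub_le _ _).trans ?_
    linarith
  · rcases le_total t s with hts | hts
    · rw [eulerExtend_of_le η f hts, eulerExtend_of_le η f hts]
      have h1 := hDl t ⟨ht.1, hts⟩ u v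
      have h2 := mul_nonneg hD (apply_nonneg p (η t u - η t v))
      linarith
    · rw [eulerExtend_of_ge η f hts, eulerExtend_of_ge η f hts]
      have h1 := hDl s hss u v
      have h2 := hτL (t - s) ⟨by linarith, by linarith [ht.2]⟩ (η s u) (η s v)
      set a := η s u
      set b := η s v
      have h3 := map_add_le_add p ((a - (t - s) • f a) - (b - (t - s) • f b))
        ((t - s) • (f a - f b))
      rw [show (a - (t - s) • f a) - (b - (t - s) • f b) + (t - s) • (f a - f b) = a - b by
        rw [smul_sub]; abel] at h3
      have h4 : p (a - b) ≤ 2 * p ((a - (t - s) • f a) - (b - (t - s) • f b)) := by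
        linarith [hp ((t - s) • (f a - f b))]
      linarith [mul_le_mul_of_nonneg_left h4 hD]
  · rw [eulerExtend, sub_right_comm]
    exact Submodule.sub_mem _ (Submodule.mem_sup_left (hFm _ (hmin t ht) u))
      (Submodule.smul_mem _ _ (Submodule.mem_sup_right (hGm _)))
  · rcases H.drop u hu with h1 | ⟨t, ht, h1⟩
    · by_cases hδ : δ ≤ p (η s u)
      · left
        have h2 := antitoneOn_comp_euler hφ (Hf.drop _ (mem_image_of_mem _ hu) hδ)
          (left_mem_Icc.2 hh.le) (right_mem_Icc.2 hh.le) hh.le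
        simp only [zero_smul, sub_zero, mul_zero, add_zero] at h2
        rw [eulerExtend_of_ge η f (by linarith), add_sub_cancel_left]
        linarith
      · exact Or.inr ⟨s, ⟨hs, by linarith⟩, by
          rw [eulerExtend_of_le η f le_rfl]; exact not_le.1 hδ⟩
    · exact Or.inr ⟨t, ⟨ht.1, by linarith [ht.2]⟩, by rwa [eulerExtend_of_le η f ht.2]⟩

/-- Descending deformations exist up to arbitrarily large times. -/
theorem exists_isDescent [CompleteSpace X] (hp : ∀ u, p u ≤ ‖u‖) {φ : X → ℝ}
    {φ' : X → X →L[ℝ] ℝ} (hφ : ∀ u, HasFDerivAt φ (φ' u) u) (heven : ∀ u, φ (-u) = φ u)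
    {ε δ R d : ℝ} (hε : 0 < ε) {K : Set X} (hKc : p.IsSeqCompactSet K) (hKs : ∀ y ∈ K, -y ∈ K)
    (hKR : ∀ y ∈ K, ‖y‖ ≤ R) (hKd : ∀ y ∈ K, φ y ≤ d)
    (hE : ∀ y, φ y ≤ d → δ ≤ p y → ε < ‖φ' y‖)
    (hτ : ∀ (R c : ℝ) (u w : X), c < φ' u w →
      ∃ r > 0, ∀ v, ‖v‖ ≤ R → p (v - u) < r → c < φ' v w) (T : ℝ) :
    ∃ (s : ℝ) (η : ℝ → X → X), T ≤ s ∧ IsDescent p φ ε δ K s η := by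
  by_contra! hcon
  have hT : ∀ s η, IsDescent p φ ε δ K s η → s < T := fun s η H =>
    not_le.1 fun h => hcon s η h H
  have hodd : ∀ u, φ' (-u) = -φ' u := fun u => by
    have h1 : HasFDerivAt φ (-φ' (-u)) u := by
      have h2 : HasFDerivAt (fun v : X => -v) (-ContinuousLinearMap.id ℝ X) u :=
        (hasFDerivAt_id u).neg
      have h3 := (hφ (-u)).comp u h2
      have h4 : φ ∘ (fun v : X => -v) = φ := funext heven
      rw [h4] at h3
      have h5 : φ' (-u) ∘SL (-ContinuousLinearMap.id ℝ X) = -φ' (-u) := by ext; simp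
      rwa [h5] at h3
    rw [(hφ u).unique h1, neg_neg]
  let State := {σ : ℝ × (ℝ → X → X) // IsDescent p φ ε δ K σ.1 σ.2}
  -- every state is extended by an Euler step at least half as long as any admissible one
  have hnext : ∀ σ : State, ∃ σ' : State, σ.1.1 ≤ σ'.1.1 ∧
      (∀ u, ‖σ'.1.2 σ'.1.1 u - σ.1.2 σ.1.1 u‖ ≤ σ'.1.1 - σ.1.1) ∧
      ∀ f h, IsEulerField p φ' ε δ (σ.1.2 σ.1.1 '' K) f h → h ≤ 2 * (σ'.1.1 - σ.1.1) := by
    rintro ⟨⟨s, η⟩, H⟩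
    set A : Set ℝ := {h | ∃ f, IsEulerField p φ' ε δ (η s '' K) f h} with hA
    have hAb : BddAbove A := ⟨1, fun h ⟨_, hf⟩ => hf.le_one⟩
    by_cases hne : A.Nonempty
    · have hpos : 0 < sSup A := by
        obtain ⟨h, f, hf⟩ := hne
        exact hf.pos.trans_le (le_csSup hAb ⟨f, hf⟩)
      obtain ⟨h, ⟨f, hf⟩, hlt⟩ := exists_lt_of_lt_csSup hne (half_lt_self hpos)
      refine ⟨⟨(s + h, eulerExtend s η f), H.extend hφ hp hf⟩, ?_, fun u => ?_,
        fun f' h' hf' => ?_⟩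
      · simpa using hf.pos.le
      · have h1 := (H.extend hφ hp hf).speed (s + h) ⟨by linarith [H.nonneg, hf.pos], le_rfl⟩ s
          ⟨H.nonneg, by linarith [hf.pos]⟩ u
        rw [eulerExtend_of_le η f le_rfl] at h1
        simpa [abs_of_pos hf.pos] using h1
      · have h1 : h' ≤ sSup A := le_csSup hAb ⟨f', hf'⟩
        simp only [add_sub_cancel_left]
        linarith
    · exact ⟨⟨(s, η), H⟩, le_rfl, fun u => by simp, fun f h hf => absurd ⟨h, f, hf⟩ hne⟩
  choose next hle hdist hmaxl using hnext
  let σ : ℕ → State := fun n => next^[n] ⟨(0, fun _ u => u), isDescent_id p φ ε δ K⟩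
  have hσ : ∀ n, σ (n + 1) = next (σ n) := fun n => Function.iterate_succ_apply' _ _ _
  set s : ℕ → ℝ := fun n => (σ n).1.1 with hs
  set g : ℕ → X → X := fun n => (σ n).1.2 (s n) with hg
  have hmono : Monotone s := monotone_nat_of_le_succ fun n => by
    simp only [hs, hσ n]; exact hle _
  have hD : ∀ n, IsDescent p φ ε δ K (s n) (σ n).1.2 := fun n => (σ n).2
  have hbdd : BddAbove (range s) := ⟨T, by rintro _ ⟨n, rfl⟩; exact (hT _ _ (hD n)).le⟩
  set S := ⨆ n, s n with hS
  have hlim : Tendsto s atTop (𝓝 S) := tendsto_atTop_ciSup hmono hbdd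
  have hsS : ∀ n, s n ≤ S := le_ciSup hbdd
  have hnn : ∀ n, s n ∈ Icc 0 (s n) := fun n => ⟨(hD n).nonneg, le_rfl⟩
  have hgd : ∀ n k u, ‖g (n + k) u - g n u‖ ≤ s (n + k) - s n := by
    intro n k u
    induction k with
    | zero => simp
    | succ k ih =>
      have h1 : ‖g (n + k + 1) u - g (n + k) u‖ ≤ s (n + k + 1) - s (n + k) := by
        simp only [hg, hs, hσ (n + k)]; exact hdist _ u
      have h2 := norm_add_le (g (n + k + 1) u - g (n + k) u) (g (n + k) u - g n u)
      rw [sub_add_sub_cancel] at h2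
      rw [← add_assoc]
      linarith
  have hcau : ∀ u, ∃ y, Tendsto (fun n => g n u) atTop (𝓝 y) := fun u => by
    refine cauchySeq_tendsto_of_complete (cauchySeq_of_le_tendsto_0' (fun n => S - s n)
      (fun n m hnm => ?_) (by simpa using hlim.const_sub S))
    obtain ⟨k, rfl⟩ := Nat.exists_eq_add_of_le hnm
    rw [dist_comm, dist_eq_norm]
    linarith [hgd n k u, hsS (n + k)]
  choose G hG using hcau
  have hGd : ∀ n u, ‖G u - g n u‖ ≤ S - s n := fun n u => by
    refine le_of_tendsto ((hG u).sub_const (g n u)).norm (eventually_atTop.2 ⟨n, fun m hm => ?_⟩)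
    obtain ⟨k, rfl⟩ := Nat.exists_eq_add_of_le hm
    linarith [hgd n k u, hsS (n + k)]
  have hgodd : ∀ n u, g n (-u) = -g n u := fun n u => (hD n).odd _ (hnn n) u
  have hgK : ∀ n, ∀ u ∈ K, φ (g n u) ≤ d := fun n u hu => by
    have h1 := (hD n).anti u hu (left_mem_Icc.2 (hD n).nonneg) (hnn n) (hD n).nonneg
    simp only [(hD n).zero] at h1
    exact h1.trans (hKd u hu)
  have hg0 : ∀ u, g 0 u = u := fun u => rfl
  have hs0 : s 0 = 0 := rfl
  have hKcG : p.IsSeqCompactSet (G '' K) := by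
    intro y hy
    choose x hxK hxy using hy
    obtain ⟨a, ha, ψ, hψ, hψl⟩ := hKc x hxK
    refine ⟨G a, mem_image_of_mem _ ha, ψ, hψ, ?_⟩
    rw [Metric.tendsto_atTop]
    intro e he
    obtain ⟨n, hn⟩ := ((tendsto_order.1 hlim).1 (S - e / 4) (by linarith)).exists
    obtain ⟨C, hC, hCl⟩ := (hD n).lip
    obtain ⟨N, hN⟩ := Metric.tendsto_atTop.1 hψl (e / 4 / (1 + C)) (by positivity)
    refine ⟨N, fun m hm => ?_⟩
    have h1 := hN m hm
    rw [Real.dist_0_eq_abs, abs_of_nonneg (apply_nonneg _ _)] at h1 ⊢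
    rw [lt_div_iff₀ (by positivity)] at h1
    rw [← hxy]
    set b := x (ψ m)
    have h2 := hCl _ (hnn n) b a
    change ‖(g n b - b) - (g n a - a)‖ ≤ _ at h2
    have h3 := map_add_le_add p (G b - g n b) ((g n a - G a)
      + (((g n b - b) - (g n a - a)) + (b - a)))
    have h4 := map_add_le_add p (g n a - G a) (((g n b - b) - (g n a - a)) + (b - a))
    have h5 := map_add_le_add p ((g n b - b) - (g n a - a)) (b - a)
    rw [show G b - g n b + (g n a - G a + (g n b - b - (g n a - a) + (b - a))) = G b - G a by
      abel] at h3
    have h6 := hp (G b - g n b)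
    have h7 := hp (g n a - G a)
    rw [norm_sub_rev] at h7
    have h8 := hp ((g n b - b) - (g n a - a))
    linarith [hGd n b, hGd n a]
  obtain ⟨f, h, ρ, hρ, hf⟩ := exists_isEulerField (δ := δ) (R := R + S) hp hodd hε hKcG
    (by
      rintro _ ⟨u, hu, rfl⟩
      refine ⟨-u, hKs u hu, tendsto_nhds_unique (hG (-u)) ?_⟩
      simpa only [hgodd] using (hG u).neg)
    (by
      rintro _ ⟨u, hu, rfl⟩
      have h1 := hGd 0 u
      rw [hg0, hs0, sub_zero] at h1
      have h2 := norm_add_le (G u - u) u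
      rw [sub_add_cancel] at h2
      linarith [hKR u hu])
    (by
      rintro _ ⟨u, hu, rfl⟩
      exact hE _ (le_of_tendsto ((hφ (G u)).continuousAt.tendsto.comp (hG u))
        (Eventually.of_forall fun n => hgK n u hu))) hτ
  have hlim0 : Tendsto (fun n => 2 * (s (n + 1) - s n)) atTop (𝓝 0) := by
    simpa using ((hlim.comp (tendsto_add_atTop_nat 1)).sub hlim).const_mul 2
  have hev : ∀ᶠ n in atTop, h ≤ 2 * (s (n + 1) - s n) := by
    filter_upwards [(tendsto_order.1 hlim).1 (S - ρ) (by linarith)] with n hn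
    have h1 : IsEulerField p φ' ε δ (g n '' K) f h := by
      refine hf _ ?_
      rintro _ ⟨u, hu, rfl⟩
      refine ⟨G u, mem_image_of_mem _ hu, ?_⟩
      rw [norm_sub_rev]
      linarith [hGd n u]
    simp only [hs, hσ n]
    exact hmaxl _ f h h1
  have h0 : 0 < h := (hf ∅ (by simp)).pos
  exact absurd (ge_of_tendsto hlim0 hev) (not_le.2 h0)

end Euler

namespace FountainSetup

variable {X : Type*} [NormedAddCommGroup X] [InnerProductSpace ℝ X] [CompleteSpace X]
variable (S : FountainSetup X)

lemma Q_eq_zero {u : X} (hu : u ∈ S.Y) : S.Q u = 0 := by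
  have h : S.Q u ∈ S.Y := by
    rw [eq_sub_of_add_eq' (S.P_add_Q u)]
    exact S.Y.sub_mem hu (S.P_mem u)
  exact inner_self_eq_zero.1 (Submodule.inner_right_of_mem_orthogonal h (S.Q_mem u))

lemma P_eq_zero {u : X} (hu : u ∈ S.Yᗮ) : S.P u = 0 := by
  have h : S.P u ∈ S.Yᗮ := by
    rw [eq_sub_of_add_eq (S.P_add_Q u)]
    exact S.Yᗮ.sub_mem hu (S.Q_mem u)
  exact inner_self_eq_zero.1 (Submodule.inner_right_of_mem_orthogonal (S.P_mem u) h)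

lemma inner_P_of_mem {y : X} (hy : y ∈ S.Y) (u : X) : ⟪S.P u, y⟫ = ⟪u, y⟫ := by
  conv_rhs => rw [← S.P_add_Q u]
  rw [inner_add_left, Submodule.inner_left_of_mem_orthogonal hy (S.Q_mem u), add_zero]

lemma inner_Q_of_mem {z : X} (hz : z ∈ S.Yᗮ) (u : X) : ⟪S.Q u, z⟫ = ⟪u, z⟫ := by
  conv_rhs => rw [← S.P_add_Q u]
  rw [inner_add_left, Submodule.inner_right_of_mem_orthogonal (S.P_mem u) hz, zero_add]

lemma norm_sq_eq (u : X) : ‖u‖ * ‖u‖ = ‖S.P u‖ * ‖S.P u‖ + ‖S.Q u‖ * ‖S.Q u‖ := by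
  conv_lhs => rw [← S.P_add_Q u]
  exact norm_add_sq_eq_norm_sq_add_norm_sq_of_inner_eq_zero _ _
    (Submodule.inner_right_of_mem_orthogonal (S.P_mem u) (S.Q_mem u))

lemma norm_P_le (u : X) : ‖S.P u‖ ≤ ‖u‖ :=
  abs_le_of_sq_le_sq' (by nlinarith [S.norm_sq_eq u]) (norm_nonneg u) |>.2

lemma norm_Q_le (u : X) : ‖S.Q u‖ ≤ ‖u‖ :=
  abs_le_of_sq_le_sq' (by nlinarith [S.norm_sq_eq u]) (norm_nonneg u) |>.2

lemma hasSum_half_pow_succ (c : ℝ) : HasSum (fun j : ℕ => (1 / 2 : ℝ) ^ (j + 1) * c) c := by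
  have h := (hasSum_geometric_two.mul_left (1 / 2 : ℝ)).mul_right c
  simpa only [pow_succ', one_div, inv_mul_cancel₀ (two_ne_zero' ℝ), one_mul] using h

lemma weight_le (u : X) (j : ℕ) :
    (1 / 2 : ℝ) ^ (j + 1) * |⟪S.P u, S.e j⟫| ≤ (1 / 2 : ℝ) ^ (j + 1) * ‖u‖ := by
  refine mul_le_mul_of_nonneg_left ?_ (by positivity)
  have h := abs_real_inner_le_norm (S.P u) (S.e j)
  rw [S.orth_e.1 j, mul_one] at h
  exact h.trans (S.norm_P_le u)

lemma summable_weight (u : X) :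
    Summable fun j : ℕ => (1 / 2 : ℝ) ^ (j + 1) * |⟪S.P u, S.e j⟫| :=
  Summable.of_nonneg_of_le (fun _ => by positivity) (S.weight_le u)
    (hasSum_half_pow_succ ‖u‖).summable

lemma tauNorm_le_norm (u : X) : S.tauNorm u ≤ ‖u‖ :=
  max_le (((S.summable_weight u).tsum_le_tsum (S.weight_le u)
    (hasSum_half_pow_succ ‖u‖).summable).trans_eq (hasSum_half_pow_succ ‖u‖).tsum_eq)
    (S.norm_Q_le u)

/-- The `τ`-norm as a seminorm. -/
def tauSeminorm : Seminorm ℝ X :=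
  Seminorm.of S.tauNorm
    (fun u v => by
      refine max_le ?_ ?_
      · refine le_trans ?_ (add_le_add (le_max_left _ _) (le_max_left _ _))
        rw [← (S.summable_weight u).tsum_add (S.summable_weight v)]
        refine (S.summable_weight (u + v)).tsum_le_tsum (fun j => ?_)
          ((S.summable_weight u).add (S.summable_weight v))
        rw [← mul_add, map_add, inner_add_left]
        exact mul_le_mul_of_nonneg_left (abs_add_le _ _) (by positivity)
      · rw [map_add]
        exact (norm_add_le _ _).trans (add_le_add (le_max_right _ _) (le_max_right _ _)))
    (fun a u => by
      simp only [tauNorm, map_smul, inner_smul_left, abs_mul, norm_smul, mul_left_comm _ |_|,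
        tsum_mul_left, RCLike.conj_to_real, Real.norm_eq_abs]
      rw [mul_max_of_nonneg _ _ (abs_nonneg a)])

lemma abs_inner_e_le (u : X) (j : ℕ) : |⟪u, S.e j⟫| ≤ 2 ^ (j + 1) * S.tauNorm u := by
  have h : (1 / 2 : ℝ) ^ (j + 1) * |⟪S.P u, S.e j⟫| ≤ S.tauNorm u :=
    ((S.summable_weight u).le_tsum j fun _ _ => by positivity).trans (le_max_left _ _)
  rw [S.inner_P_of_mem (S.e_mem j), one_div, inv_pow, inv_mul_le_iff₀ (by positivity)] at h
  exact h

/-- Bounded `τ`-convergent sequences converge weakly. -/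
lemma weakConv_of_tauTendsto {u : ℕ → X} {v : X} {R : ℝ} (hR : ∀ n, ‖u n‖ ≤ R)
    (h : S.TauTendsto u v) : WeakConv u v := by
  set D : Submodule ℝ X :=
    { carrier := {w | Tendsto (fun n => ⟪u n - v, w⟫) atTop (𝓝 0)}
      zero_mem' := by simp
      add_mem' := fun ha hb => by
        simpa only [Set.mem_ofPred_eq, inner_add_right, add_zero] using ha.add hb
      smul_mem' := fun c a ha => by
        simpa only [Set.mem_ofPred_eq, inner_smul_right, mul_zero] using ha.const_mul c } with hD
  have hmem : ∀ w, w ∈ D ↔ Tendsto (fun n => ⟪u n - v, w⟫) atTop (𝓝 0) := fun w => Iff.rfl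
  have hb : ∀ n, ‖u n - v‖ ≤ R + ‖v‖ := fun n => (norm_sub_le _ _).trans (by linarith [hR n])
  have hC : 0 ≤ R + ‖v‖ := (norm_nonneg _).trans (hb 0)
  have hclosed : IsClosed (D : Set X) := by
    refine isClosed_of_closure_subset fun w hw => ?_
    rw [SetLike.mem_coe, hmem, Metric.tendsto_atTop]
    intro e he
    obtain ⟨w', hw', hd⟩ := Metric.mem_closure_iff.1 hw (e / 2 / (R + ‖v‖ + 1)) (by positivity)
    obtain ⟨N, hN⟩ := Metric.tendsto_atTop.1 ((hmem w').1 hw') (e / 2) (by positivity)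
    refine ⟨N, fun n hn => ?_⟩
    have h1 := hN n hn
    rw [Real.dist_0_eq_abs] at h1 ⊢
    rw [dist_eq_norm, lt_div_iff₀ (by positivity)] at hd
    have h2 := abs_real_inner_le_norm (u n - v) (w - w')
    have h3 := mul_le_mul_of_nonneg_right (hb n) (norm_nonneg (w - w'))
    have h4 : ⟪u n - v, w⟫ = ⟪u n - v, w - w'⟫ + ⟪u n - v, w'⟫ := by
      rw [← inner_add_right, sub_add_cancel]
    rw [h4]
    have h5 := abs_add_le ⟪u n - v, w - w'⟫ ⟪u n - v, w'⟫
    nlinarith [norm_nonneg (w - w')]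
  have hY : S.Y ≤ D := by
    rw [← S.span_e]
    refine Submodule.topologicalClosure_minimal _ (Submodule.span_le.2 ?_) hclosed
    rintro _ ⟨j, rfl⟩
    refine squeeze_zero_norm (fun n => S.abs_inner_e_le (u n - v) j) ?_
    simpa using Tendsto.const_mul (2 ^ (j + 1) : ℝ) h
  have hZ : S.Yᗮ ≤ D := by
    intro z hz
    refine squeeze_zero_norm (a := fun n => S.tauNorm (u n - v) * ‖z‖) (fun n => ?_) ?_
    · rw [← S.inner_Q_of_mem hz]
      exact (norm_inner_le_norm _ _).trans
        (mul_le_mul_of_nonneg_right (le_max_right _ _) (norm_nonneg _))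
    · simpa using Tendsto.mul_const ‖z‖ h
  intro w
  have hw : w ∈ D := by
    rw [← S.P_add_Q w]
    exact D.add_mem (hY (S.P_mem w)) (hZ (S.Q_mem w))
  simpa [inner_sub_left] using ((hmem w).1 hw).add_const ⟪v, w⟫

/-- On bounded sets the derivative in a fixed direction is `τ`-lower semicontinuous. -/
lemma exists_tauNorm_lt_imp_lt {φ' : X → X →L[ℝ] ℝ} (h : WeaklySeqContDeriv φ') (R c : ℝ)
    (u w : X) (hc : c < φ' u w) :
    ∃ r > 0, ∀ v, ‖v‖ ≤ R → S.tauNorm (v - u) < r → c < φ' v w := by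
  by_contra! hcon
  choose v hvR hvτ hv using fun n : ℕ => hcon (1 / (n + 1)) Nat.one_div_pos_of_nat
  have hτ : S.TauTendsto v u := squeeze_zero (fun n => apply_nonneg S.tauSeminorm _)
    (fun n => (hvτ n).le) tendsto_one_div_add_atTop_nhds_zero_nat
  exact absurd (le_of_tendsto (h v u (S.weakConv_of_tauTendsto hvR hτ) w)
    (Eventually.of_forall hv)) (not_le.2 hc)

lemma Q_eq_sum_iff (k : ℕ) (u : X) :
    u ∈ S.Yk k ↔ S.Q u = ∑ j ∈ Finset.range (k + 1), ⟪S.f j, u⟫ • S.f j := by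
  constructor
  · set L : X →L[ℝ] X := ∑ j ∈ Finset.range (k + 1), (innerSL ℝ (S.f j)).smulRight (S.f j)
    have hL : ∀ u, L u = ∑ j ∈ Finset.range (k + 1), ⟪S.f j, u⟫ • S.f j := fun u => by
      simp [L]
    have hle : S.Yk k ≤ LinearMap.ker (S.Q - L).toLinearMap := by
      refine sup_le (fun y hy => ?_) (Submodule.span_le.2 ?_)
      · simp [hL, S.Q_eq_zero hy, Submodule.inner_left_of_mem_orthogonal hy (S.f_mem _)]
      · rintro _ ⟨i, hi, rfl⟩
        have hQ : S.Q (S.f i) = S.f i := by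
          simpa [S.P_eq_zero (S.f_mem i)] using S.P_add_Q (S.f i)
        have hi' : i < k + 1 := Nat.lt_succ_of_le hi
        simp [hL, hQ, orthonormal_iff_ite.1 S.orth_f, hi']
    intro hu
    have h : (S.Q - L) u = 0 := hle hu
    rw [← hL u]
    simpa [sub_eq_zero] using h
  · intro h
    rw [← S.P_add_Q u, h]
    refine Submodule.add_mem_sup (S.P_mem u) (Submodule.sum_mem _ fun j hj => ?_)
    exact Submodule.smul_mem _ _ (Submodule.subset_span
      ⟨j, Nat.lt_succ_iff.1 (Finset.mem_range.1 hj), rfl⟩)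

lemma exists_weakConv_subseq [TopologicalSpace.SeparableSpace X] (u : ℕ → X) {R : ℝ}
    (hR : ∀ n, ‖u n‖ ≤ R) :
    ∃ (a : X) (ψ : ℕ → ℕ), ‖a‖ ≤ R ∧ StrictMono ψ ∧ WeakConv (u ∘ ψ) a := by
  obtain ⟨a, ha, ψ, hψ, hlim⟩ := WeakDual.isSeqCompact_closedBall ℝ X 0 R
    (x := fun n => StrongDual.toWeakDual (InnerProductSpace.toDual ℝ X (u n)))
    (fun n => by
      simpa using hR n)
  refine ⟨(InnerProductSpace.toDual ℝ X).symm (WeakDual.toStrongDual a), ψ, by simpa using ha,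
    hψ, fun w => ?_⟩
  have h := ((WeakDual.eval_continuous w).tendsto a).comp hlim
  rw [InnerProductSpace.toDual_symm_apply]
  exact h

lemma isSeqCompactSet_closedBall (k : ℕ) (ρ : ℝ) :
    S.tauSeminorm.IsSeqCompactSet {u : X | u ∈ S.Yk k ∧ ‖u‖ ≤ ρ} := by
  intro u hu
  have := S.separable
  obtain ⟨a, ψ, ha, hψ, hlim⟩ := exists_weakConv_subseq u fun n => (hu n).2
  have hQ : Tendsto (fun n => S.Q (u (ψ n))) atTop
      (𝓝 (∑ j ∈ Finset.range (k + 1), ⟪S.f j, a⟫ • S.f j)) := by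
    have h : ∀ n, S.Q (u (ψ n)) = ∑ j ∈ Finset.range (k + 1), ⟪S.f j, u (ψ n)⟫ • S.f j :=
      fun n => (S.Q_eq_sum_iff k _).1 (hu (ψ n)).1
    simp only [h]
    refine tendsto_finsetSum _ fun j _ => Tendsto.smul_const ?_ _
    simpa only [real_inner_comm, Function.comp_apply] using hlim (S.f j)
  have hQa : S.Q a = ∑ j ∈ Finset.range (k + 1), ⟪S.f j, a⟫ • S.f j := by
    refine ext_inner_right ℝ fun w => ?_
    refine tendsto_nhds_unique ?_ (hQ.inner tendsto_const_nhds)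
    have h : ∀ v, ⟪S.Q v, w⟫ = ⟪v, S.Q w⟫ := fun v => by
      rw [← S.inner_Q_of_mem (S.Q_mem w) v]
      conv_lhs => rw [← S.P_add_Q w]
      rw [inner_add_right, Submodule.inner_left_of_mem_orthogonal (S.P_mem w) (S.Q_mem v),
        zero_add]
    simp only [h]
    exact hlim (S.Q w)
  refine ⟨a, ⟨(S.Q_eq_sum_iff k a).2 hQa, ha⟩, ψ, hψ, ?_⟩
  have hP : Tendsto (fun n => ∑' j : ℕ, (1 / 2 : ℝ) ^ (j + 1) * |⟪S.P (u (ψ n) - a), S.e j⟫|)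
      atTop (𝓝 (∑' _ : ℕ, (0 : ℝ))) := by
    refine tendsto_tsum_of_dominated_convergence (hasSum_half_pow_succ (ρ + ρ)).summable
      (fun j => ?_) (Eventually.of_forall fun n j => ?_)
    · have h : Tendsto (fun n => ⟪u (ψ n) - a, S.e j⟫) atTop (𝓝 0) := by
        simpa [inner_sub_left] using (hlim (S.e j)).sub_const ⟪a, S.e j⟫
      simp only [S.inner_P_of_mem (S.e_mem j)]
      simpa using h.abs.const_mul ((1 / 2 : ℝ) ^ (j + 1))
    · rw [Real.norm_of_nonneg (by positivity)]
      refine (S.weight_le _ j).trans (mul_le_mul_of_nonneg_left ?_ (by positivity))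
      exact (norm_sub_le _ _).trans (add_le_add (hu (ψ n)).2 ha)
  rw [tsum_zero] at hP
  have hQ0 : Tendsto (fun n => ‖S.Q (u (ψ n) - a)‖) atTop (𝓝 0) := by
    rw [← hQa] at hQ
    simpa using (hQ.sub_const (S.Q a)).norm
  have h := hP.max hQ0
  rwa [max_self] at h

end FountainSetup

/-- **Deformation lemma (Lemma 2.2).**  Under the hypotheses of Lemma 2.1, set
`E = {u : φ(u) ≤ d_k + 1, ‖u‖_τ ≥ δ/2}`.  If `ε ∈ (0, 1/2)` satisfies
`0 < ε < b_k − max{a_k, sup_{‖u‖_τ<δ} φ(u)}` and `‖φ'(u)‖ > ε` on `E`,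
then there are `T > 0` and a continuous map `η : [0,T] × B_k → X`
satisfying (i)–(v). -/
theorem deformation_lemma
    {X : Type*} [NormedAddCommGroup X] [InnerProductSpace ℝ X] [CompleteSpace X]
    (S : FountainSetup X) (φ : X → ℝ) (φ' : X → X →L[ℝ] ℝ)
    -- φ ∈ C¹(X, ℝ)
    (hderiv : ∀ u, HasFDerivAt φ (φ' u) u) (hC1 : Continuous φ')
    -- φ is even
    (heven : ∀ u, φ (-u) = φ u)
    -- ∇φ is weakly sequentially continuous
    (hwsc : WeaklySeqContDeriv φ')
    (k : ℕ) (ρkv rkv δ : ℝ) (hr : 0 < rkv) (hρr : rkv < ρkv) (hδ : 0 < δ)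
    -- the numbers d_k, a_k, b_k and sup_{‖u‖_τ < δ} φ(u)
    (dk ak bk sτ : ℝ)
    (hdk : dk = sSup (φ '' {u : X | u ∈ S.Yk k ∧ ‖u‖ ≤ ρkv}))
    (hak : ak = sSup (φ '' {u : X | u ∈ S.Yk k ∧ ‖u‖ = ρkv}))
    (hbk : bk = sInf (φ '' {u : X | u ∈ S.Zk k ∧ ‖u‖ = rkv}))
    (hsτ : sτ = sSup (φ '' {u : X | S.tauNorm u < δ}))
    -- finiteness of the various suprema/infima
    (hbdd1 : BddAbove (φ '' {u : X | u ∈ S.Yk k ∧ ‖u‖ ≤ ρkv}))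
    (hbdd2 : BddBelow (φ '' {u : X | u ∈ S.Zk k ∧ ‖u‖ ≤ rkv}))
    (hbdd3 : BddBelow (φ '' {u : X | u ∈ S.Zk k ∧ ‖u‖ = rkv}))
    (hbdd4 : BddAbove (φ '' {u : X | S.tauNorm u < δ}))
    -- (A₂)' : a_k < inf {φ(u) : u ∈ Z_k, ‖u‖ ≤ r_k}
    (hA2' : ak < sInf (φ '' {u : X | u ∈ S.Zk k ∧ ‖u‖ ≤ rkv}))
    -- (2.1) : b_k > sup {φ(u) : ‖u‖_τ < δ}
    (hgap : sτ < bk)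
    -- ε ∈ (0, 1/2) with 0 < ε < b_k − max{a_k, sup_{‖u‖_τ<δ} φ(u)}
    (ε : ℝ) (hε0 : 0 < ε) (hε2 : ε < 1 / 2) (hε : ε < bk - max ak sτ)
    -- ‖φ'(u)‖ > ε on E = {u : φ(u) ≤ d_k + 1, ‖u‖_τ ≥ δ/2}
    (hE : ∀ u : X, φ u ≤ dk + 1 → δ / 2 ≤ S.tauNorm u → ε < ‖φ' u‖) :
    ∃ T : ℝ, 0 < T ∧ ∃ η : ℝ → X → X,
      -- η ∈ C([0,T] × B_k, X)
      ContinuousOn (fun p : ℝ × X => η p.1 p.2) (Icc (0:ℝ) T ×ˢ S.Bk k ρkv) ∧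
      -- (i) η(0,u) = u and η(t,−u) = −η(t,u)
      (∀ u ∈ S.Bk k ρkv, η 0 u = u) ∧
      (∀ t ∈ Icc (0:ℝ) T, ∀ u ∈ S.Bk k ρkv, η t (-u) = -η t u) ∧
      -- (ii) t ↦ φ(η(t,u)) is non-increasing
      (∀ u ∈ S.Bk k ρkv, AntitoneOn (fun t => φ (η t u)) (Icc (0:ℝ) T)) ∧
      -- (iii) η is τ-continuous …
      (∀ (tm : ℕ → ℝ) (um : ℕ → X) (t : ℝ) (u : X),
        (∀ m, tm m ∈ Icc (0:ℝ) T) → (∀ m, um m ∈ S.Bk k ρkv) →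
        t ∈ Icc (0:ℝ) T → u ∈ S.Bk k ρkv →
        Tendsto tm atTop (𝓝 t) → S.TauTendsto um u →
        S.TauTendsto (fun m => η (tm m) (um m)) (η t u)) ∧
      -- … and η(t,·) : B_k → η(t,B_k) is a τ-homeomorphism
      (∀ t ∈ Icc (0:ℝ) T, Set.InjOn (η t) (S.Bk k ρkv) ∧
        ∀ (um : ℕ → X) (u : X), (∀ m, um m ∈ S.Bk k ρkv) → u ∈ S.Bk k ρkv →
          S.TauTendsto (fun m => η t (um m)) (η t u) → S.TauTendsto um u) ∧
      -- (iv) η(T, B_k) ⊆ φ^{b_k − ε}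
      (∀ u ∈ S.Bk k ρkv, φ (η T u) ≤ bk - ε) ∧
      -- (v) locally finite-dimensional displacement in the |·| × τ topology
      (∀ t ∈ Icc (0:ℝ) T, ∀ u ∈ S.Bk k ρkv,
        ∃ a : ℝ, 0 < a ∧ ∃ F : Submodule ℝ X, FiniteDimensional ℝ F ∧
          ∀ s : ℝ, ∀ v : X, |s - t| < a → S.tauNorm (v - u) < a →
            s ∈ Icc (0:ℝ) T → v ∈ S.Bk k ρkv → v - η s v ∈ F) := by
  set p := S.tauSeminorm with hpdef
  set K : Set X := {u : X | u ∈ S.Yk k ∧ ‖u‖ ≤ ρkv} with hK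
  have hBK : S.Bk k ρkv ⊆ K := fun u hu => ⟨hu.1, hu.2.le⟩
  have hp : ∀ u, p u ≤ ‖u‖ := S.tauNorm_le_norm
  obtain ⟨s, η, hTs, H⟩ := exists_isDescent (p := p) (δ := δ / 2) (d := dk) (K := K) hp hderiv
    heven hε0 (S.isSeqCompactSet_closedBall k ρkv)
    (fun y hy => ⟨Submodule.neg_mem _ hy.1, by simpa using hy.2⟩) (fun y hy => hy.2)
    (fun y hy => hdk ▸ le_csSup hbdd1 (mem_image_of_mem φ hy))
    (fun y hy hδy => hE y (by linarith) hδy)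
    (fun R c u w hc => S.exists_tauNorm_lt_imp_lt hwsc R c u w hc)
    (max 1 ((dk - bk + ε) / ε))
  have hs : 0 < s := one_pos.trans_le ((le_max_left _ _).trans hTs)
  have hss : s ∈ Icc 0 s := ⟨hs.le, le_rfl⟩
  obtain ⟨C, hC, hlip⟩ := H.lip
  obtain ⟨D, hD, hanti⟩ := H.antilip
  obtain ⟨F, hF, hfin⟩ := H.fin
  have hdiff : ∀ t ∈ Icc 0 s, ∀ t' ∈ Icc 0 s, ∀ u v,
      η t u - η t' v = (η t u - η t' u) + ((η t' u - u) - (η t' v - v)) + (u - v) := by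
    intros; abel
  have hnorm : ∀ t ∈ Icc 0 s, ∀ t' ∈ Icc 0 s, ∀ u v,
      ‖η t u - η t' v‖ ≤ |t - t'| + (C + 1) * ‖u - v‖ := fun t ht t' ht' u v => by
    rw [hdiff t ht t' ht' u v]
    refine (norm_add₃_le).trans ?_
    linarith [H.speed t ht t' ht' u, hlip t' ht' u v, mul_le_mul_of_nonneg_left (hp (u - v)) hC]
  have htau : ∀ t ∈ Icc 0 s, ∀ t' ∈ Icc 0 s, ∀ u v,
      p (η t u - η t' v) ≤ |t - t'| + (C + 1) * p (u - v) := fun t ht t' ht' u v => by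
    rw [hdiff t ht t' ht' u v]
    have h1 := map_add_le_add p (η t u - η t' u + ((η t' u - u) - (η t' v - v))) (u - v)
    have h2 := map_add_le_add p (η t u - η t' u) ((η t' u - u) - (η t' v - v))
    linarith [H.speed t ht t' ht' u, hlip t' ht' u v, hp (η t u - η t' u),
      hp ((η t' u - u) - (η t' v - v))]
  refine ⟨s, hs, η, ?_, fun u _ => H.zero u, fun t ht u _ => H.odd t ht u,
    fun u hu => H.anti u (hBK hu), ?_, fun t ht => ⟨fun u _ v _ huv => ?_, ?_⟩, fun u hu => ?_,
    fun t _ u _ => ⟨1, one_pos, F, hF, fun t' v _ _ ht' _ => ?_⟩⟩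
  · rintro ⟨t, u⟩ ⟨ht, -⟩
    rw [ContinuousWithinAt, tendsto_iff_norm_sub_tendsto_zero]
    have hc : Continuous fun q : ℝ × X => |q.1 - t| + (C + 1) * ‖q.2 - u‖ := by fun_prop
    refine squeeze_zero' (Eventually.of_forall fun _ => norm_nonneg _)
      (eventually_mem_nhdsWithin.mono fun q hq => hnorm q.1 hq.1 t ht q.2 u) ?_
    simpa using (hc.tendsto (t, u)).mono_left nhdsWithin_le_nhds
  · intro tm um t u htm _ ht _ hlim hτ
    refine squeeze_zero (fun n => apply_nonneg p _)
      (fun n => htau (tm n) (htm n) t ht (um n) u) ?_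
    have hτ' : Tendsto (fun n => p (um n - u)) atTop (𝓝 0) := hτ
    simpa using (hlim.sub_const t).abs.add (hτ'.const_mul (C + 1))
  · have h1 := hanti t ht u v
    rw [huv, sub_self, map_zero, mul_zero] at h1
    have h2 := hlip t ht u v
    rw [huv, sub_sub_sub_cancel_left] at h2
    have h3 := h2.trans (mul_nonpos_of_nonneg_of_nonpos hC h1)
    exact (sub_eq_zero.1 (norm_le_zero_iff.1 h3)).symm
  · intro um u _ _ hτ
    refine squeeze_zero (fun n => apply_nonneg p _) (fun n => hanti t ht (um n) u) ?_
    have hτ' : Tendsto (fun n => p (η t (um n) - η t u)) atTop (𝓝 0) := hτ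
    simpa using hτ'.const_mul D
  · rcases H.drop u (hBK hu) with h | ⟨t, ht, h⟩
    · have h1 : φ u ≤ dk := hdk ▸ le_csSup hbdd1 (mem_image_of_mem φ (hBK hu))
      have h2 := (le_max_right _ _).trans hTs
      rw [div_le_iff₀ hε0] at h2
      linarith
    · have h1 : φ (η t u) ≤ sτ := hsτ ▸ le_csSup hbdd4
        (mem_image_of_mem φ (show S.tauNorm (η t u) < δ from lt_trans h (by linarith)))
      have h2 : φ (η s u) ≤ φ (η t u) := H.anti u (hBK hu) ht hss ht.2
      linarith [le_max_right ak sτ]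
  · rw [← neg_sub]
    exact F.neg_mem (hfin t' ht' v)

end
end

section
/- Let X be a separable Hilbert space with X = Y ⊕ Z as in the setup. For k ≥ 1 define ẽ_j = f_j for 0 ≤ j ≤ k−1 and ẽ_j = e_{j−k} for j ≥ k, and define the τ_k-norm ‖u‖_{τ_k} = max{ Σ_{j=0}^{∞} 2^{-(j+1)} |⟨P_k u, ẽ_j⟩| , ‖Q_k u‖ }, where P_k, Q_k are the orthogonal projections onto Y_{k-1} and Z_k respectively. Then ‖·‖_{τ_k} and the τ-norm ‖·‖_τ are equivalent norms on X for every k ≥ 1; in particular, for k = 1 one has ‖u‖_τ² ≤ 8 ‖u‖_{τ_1}² and ‖u‖_{τ_1} ≤ 2^{3/2} ‖u‖_τ for all u ∈ X. -/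
open Filter Topology Metric Set
open scoped RealInnerProductSpace

noncomputable section

/-- The reordered basis `ẽ_j = f_j` for `0 ≤ j ≤ k−1` and `ẽ_j = e_{j−k}` for `j ≥ k`. -/
def FountainSetup.etilde {X : Type*} [NormedAddCommGroup X] [InnerProductSpace ℝ X]
    [CompleteSpace X] (S : FountainSetup X) (k j : ℕ) : X :=
  if j < k then S.f j else S.e (j - k)

/-- The τ_k-norm `‖u‖_{τ_k} = max { Σ_j 2^{-(j+1)} |⟨P_k u, ẽ_j⟩| , ‖Q_k u‖ }`, where
`P_k`, `Q_k` are the orthogonal projections onto `Y_{k-1}` and `Z_k`. -/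
def FountainSetup.tauKNorm {X : Type*} [NormedAddCommGroup X] [InnerProductSpace ℝ X]
    [CompleteSpace X] (S : FountainSetup X) (k : ℕ) (Pk Qk : X →L[ℝ] X) (u : X) : ℝ :=
  max (∑' j : ℕ, (1 / 2 : ℝ) ^ (j + 1) * |⟪Pk u, S.etilde k j⟫|) ‖Qk u‖

namespace FountainSetup

variable {X : Type*} [NormedAddCommGroup X] [InnerProductSpace ℝ X] [CompleteSpace X]
variable (S : FountainSetup X)

theorem inner_P_e (u : X) (j : ℕ) : ⟪S.P u, S.e j⟫ = ⟪u, S.e j⟫ := by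
  conv_rhs => rw [← S.P_add_Q u, inner_add_left]
  rw [Submodule.inner_left_of_mem_orthogonal (S.e_mem j) (S.Q_mem u), add_zero]

theorem inner_Q_f (u : X) (j : ℕ) : ⟪S.Q u, S.f j⟫ = ⟪u, S.f j⟫ := by
  conv_rhs => rw [← S.P_add_Q u, inner_add_left]
  rw [Submodule.inner_right_of_mem_orthogonal (S.P_mem u) (S.f_mem j), zero_add]

theorem Zk_le_orthogonal (k : ℕ) : S.Zk k ≤ S.Yᗮ := by
  refine Submodule.topologicalClosure_minimal _ ?_ S.Y.isClosed_orthogonal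
  rw [Submodule.span_le]
  rintro _ ⟨j, -, rfl⟩
  exact S.f_mem j

theorem inner_f_of_mem_Zk {k j : ℕ} {x : X} (hx : x ∈ S.Zk k) (hj : j < k) :
    ⟪x, S.f j⟫ = 0 := by
  have h : S.Zk k ≤ (ℝ ∙ S.f j)ᗮ := by
    refine Submodule.topologicalClosure_minimal _ ?_ (Submodule.isClosed_orthogonal _)
    rw [Submodule.span_le]
    rintro _ ⟨i, hi, rfl⟩
    exact Submodule.mem_orthogonal_singleton_iff_inner_left.2
      (S.orth_f.2 (hj.trans_le hi).ne')
  exact Submodule.mem_orthogonal_singleton_iff_inner_left.1 (h hx)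

theorem inner_f_of_mem_Yk {k j : ℕ} {x : X} (hx : x ∈ S.Yk k) (hj : k < j) :
    ⟪x, S.f j⟫ = 0 := by
  have h : S.Yk k ≤ (ℝ ∙ S.f j)ᗮ := by
    refine sup_le (fun y hy ↦ ?_) ?_
    · exact Submodule.mem_orthogonal_singleton_iff_inner_left.2
        (Submodule.inner_right_of_mem_orthogonal hy (S.f_mem j))
    · rw [Submodule.span_le]
      rintro _ ⟨i, hi, rfl⟩
      exact Submodule.mem_orthogonal_singleton_iff_inner_left.2
        (S.orth_f.2 (lt_of_le_of_lt hi hj).ne)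
  exact Submodule.mem_orthogonal_singleton_iff_inner_left.1 (h hx)

theorem eq_zero_of_mem_orthogonal {w : X} (hw : w ∈ S.Yᗮ) (h : ∀ j, ⟪w, S.f j⟫ = 0) :
    w = 0 := by
  have hle : S.Yᗮ ≤ (ℝ ∙ w)ᗮ := by
    rw [← S.span_f]
    refine Submodule.topologicalClosure_minimal _ ?_ (Submodule.isClosed_orthogonal _)
    rw [Submodule.span_le]
    rintro _ ⟨j, rfl⟩
    exact Submodule.mem_orthogonal_singleton_iff_inner_right.2 (h j)
  exact inner_self_eq_zero.1 (Submodule.mem_orthogonal_singleton_iff_inner_right.1 (hle hw))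

theorem summable_weighted_inner (u : X) :
    Summable fun j : ℕ ↦ (1 / 2 : ℝ) ^ (j + 1) * |⟪u, S.e j⟫| := by
  refine Summable.of_nonneg_of_le (fun j ↦ by positivity) (fun j ↦ ?_)
    (((summable_nat_add_iff 1).2 summable_geometric_two).mul_right ‖u‖)
  gcongr
  simpa [S.orth_e.1 j] using abs_real_inner_le_norm u (S.e j)

variable {k : ℕ} {Pk Qk : X →L[ℝ] X}

theorem Q_eq_sum_add (hk : 1 ≤ k) (hPk : ∀ u, Pk u ∈ S.Yk (k - 1))
    (hQk : ∀ u, Qk u ∈ S.Zk k) (hPQk : ∀ u, Pk u + Qk u = u) (u : X) :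
    S.Q u = ∑ j ∈ Finset.range k, ⟪u, S.f j⟫ • S.f j + Qk u := by
  rw [← sub_eq_zero]
  refine S.eq_zero_of_mem_orthogonal (sub_mem (S.Q_mem u) (add_mem
    (sum_mem fun j _ ↦ Submodule.smul_mem _ _ (S.f_mem j))
    (S.Zk_le_orthogonal k (hQk u)))) fun j ↦ ?_
  have hu : ⟪Pk u, S.f j⟫ + ⟪Qk u, S.f j⟫ = ⟪u, S.f j⟫ := by
    rw [← inner_add_left, hPQk]
  have hsum : ⟪∑ i ∈ Finset.range k, ⟪u, S.f i⟫ • S.f i, S.f j⟫ =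
      if j < k then ⟪u, S.f j⟫ else 0 := by
    simp [sum_inner, real_inner_smul_left, orthonormal_iff_ite.1 S.orth_f]
  rw [inner_sub_left, inner_add_left, S.inner_Q_f, hsum]
  split_ifs with hj
  · rw [S.inner_f_of_mem_Zk (hQk u) hj]
    ring
  · rw [S.inner_f_of_mem_Yk (hPk u) (by omega)] at hu
    linarith

theorem norm_Q_sq (hk : 1 ≤ k) (hPk : ∀ u, Pk u ∈ S.Yk (k - 1))
    (hQk : ∀ u, Qk u ∈ S.Zk k) (hPQk : ∀ u, Pk u + Qk u = u) (u : X) :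
    ‖S.Q u‖ ^ 2 = ‖∑ j ∈ Finset.range k, ⟪u, S.f j⟫ • S.f j‖ ^ 2 + ‖Qk u‖ ^ 2 := by
  rw [S.Q_eq_sum_add hk hPk hQk hPQk u]
  simp only [sq]
  refine norm_add_sq_eq_norm_sq_add_norm_sq_real ?_
  rw [sum_inner]
  refine Finset.sum_eq_zero fun j hj ↦ ?_
  rw [real_inner_smul_left, real_inner_comm (Qk u),
    S.inner_f_of_mem_Zk (hQk u) (Finset.mem_range.1 hj), mul_zero]

/-- The weighted series in the `τ_k`-norm splits into its first `k` terms and a rescaled copy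
of the weighted series in the `τ`-norm. -/
theorem tsum_etilde (hQk : ∀ u, Qk u ∈ S.Zk k) (hPQk : ∀ u, Pk u + Qk u = u) (u : X) :
    ∑' j : ℕ, (1 / 2 : ℝ) ^ (j + 1) * |⟪Pk u, S.etilde k j⟫| =
      ∑ j ∈ Finset.range k, (1 / 2 : ℝ) ^ (j + 1) * |⟪u, S.f j⟫| +
        (1 / 2 : ℝ) ^ k * ∑' j : ℕ, (1 / 2 : ℝ) ^ (j + 1) * |⟪S.P u, S.e j⟫| := by
  have hu (x : X) : ⟪Pk u, x⟫ + ⟪Qk u, x⟫ = ⟪u, x⟫ := by rw [← inner_add_left, hPQk]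
  have htail (j : ℕ) : (1 / 2 : ℝ) ^ (j + k + 1) * |⟪Pk u, S.etilde k (j + k)⟫| =
      (1 / 2 : ℝ) ^ k * ((1 / 2 : ℝ) ^ (j + 1) * |⟪u, S.e j⟫|) := by
    have h := hu (S.e j)
    rw [Submodule.inner_left_of_mem_orthogonal (S.e_mem j)
      (S.Zk_le_orthogonal k (hQk u)), add_zero] at h
    simp only [etilde, Nat.not_lt.2 (Nat.le_add_left k j), if_false, Nat.add_sub_cancel, h]
    ring
  have hsummable : Summable fun j : ℕ ↦
      (1 / 2 : ℝ) ^ (j + 1) * |⟪Pk u, S.etilde k j⟫| := by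
    rw [← summable_nat_add_iff k]
    simpa only [htail] using (S.summable_weighted_inner u).mul_left _
  rw [← hsummable.sum_add_tsum_nat_add k]
  simp only [htail, tsum_mul_left, S.inner_P_e]
  congr 1
  refine Finset.sum_congr rfl fun j hj ↦ ?_
  have hj := Finset.mem_range.1 hj
  have h := hu (S.f j)
  rw [S.inner_f_of_mem_Zk (hQk u) hj, add_zero] at h
  rw [etilde, if_pos hj, h]

theorem tauNorm_nonneg (u : X) : 0 ≤ S.tauNorm u :=
  (norm_nonneg _).trans (le_max_right _ _)

theorem tauKNorm_nonneg (u : X) : 0 ≤ S.tauKNorm k Pk Qk u :=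
  (norm_nonneg _).trans (le_max_right _ _)

theorem tauKNorm_le_tauNorm (hk : 1 ≤ k) (hPk : ∀ u, Pk u ∈ S.Yk (k - 1))
    (hQk : ∀ u, Qk u ∈ S.Zk k) (hPQk : ∀ u, Pk u + Qk u = u) (u : X) :
    S.tauKNorm k Pk Qk u ≤ S.tauNorm u := by
  refine max_le ?_ (le_max_of_le_right ?_)
  · rw [S.tsum_etilde hQk hPQk u]
    have hgeom : ∑ j ∈ Finset.range k, (1 / 2 : ℝ) ^ (j + 1) = 1 - (1 / 2 : ℝ) ^ k := by
      simp only [pow_succ, ← Finset.sum_mul]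
      rw [geom_sum_eq (by norm_num)]
      ring
    have hf (j : ℕ) : |⟪u, S.f j⟫| ≤ S.tauNorm u := by
      rw [← S.inner_Q_f]
      refine le_trans ?_ (le_max_right _ _)
      simpa [S.orth_f.1 j] using abs_real_inner_le_norm (S.Q u) (S.f j)
    calc _ ≤ ∑ j ∈ Finset.range k, (1 / 2 : ℝ) ^ (j + 1) * S.tauNorm u +
            (1 / 2 : ℝ) ^ k * S.tauNorm u := by
          gcongr with j hj
          · exact hf j
          · exact le_max_left _ _
      _ = S.tauNorm u := by
          rw [← Finset.sum_mul, hgeom]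
          ring
  · refine le_of_sq_le_sq ?_ (norm_nonneg _)
    rw [S.norm_Q_sq hk hPk hQk hPQk u]
    exact le_add_of_nonneg_left (sq_nonneg _)

theorem tauNorm_sq_le (hk : 1 ≤ k) (hPk : ∀ u, Pk u ∈ S.Yk (k - 1))
    (hQk : ∀ u, Qk u ∈ S.Zk k) (hPQk : ∀ u, Pk u + Qk u = u) (u : X) :
    S.tauNorm u ^ 2 ≤ (((2 : ℝ) ^ k) ^ 2 + 1) * S.tauKNorm k Pk Qk u ^ 2 := by
  set T := S.tauKNorm k Pk Qk u
  set A := ∑' j : ℕ, (1 / 2 : ℝ) ^ (j + 1) * |⟪S.P u, S.e j⟫|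
  have hA0 : 0 ≤ A := tsum_nonneg fun j ↦ by positivity
  have hsum0 : 0 ≤ ∑ j ∈ Finset.range k, (1 / 2 : ℝ) ^ (j + 1) * |⟪u, S.f j⟫| :=
    Finset.sum_nonneg fun j _ ↦ by positivity
  have hle : ∑ j ∈ Finset.range k, (1 / 2 : ℝ) ^ (j + 1) * |⟪u, S.f j⟫| +
      (1 / 2 : ℝ) ^ k * A ≤ T := by
    rw [← S.tsum_etilde hQk hPQk u]
    exact le_max_left _ _
  have hpow : (2 : ℝ) ^ k * (1 / 2 : ℝ) ^ k = 1 := by rw [← mul_pow]; norm_num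
  have hA_le : A ≤ 2 ^ k * T := by
    calc A = 2 ^ k * ((1 / 2 : ℝ) ^ k * A) := by rw [← mul_assoc, hpow, one_mul]
      _ ≤ 2 ^ k * T := by gcongr; linarith
  have hhead : ‖∑ j ∈ Finset.range k, ⟪u, S.f j⟫ • S.f j‖ ≤ 2 ^ k * T := by
    calc _ ≤ ∑ j ∈ Finset.range k, |⟪u, S.f j⟫| := by
          refine (norm_sum_le _ _).trans_eq (Finset.sum_congr rfl fun j _ ↦ ?_)
          rw [norm_smul, S.orth_f.1 j, mul_one, Real.norm_eq_abs]
      _ ≤ ∑ j ∈ Finset.range k, 2 ^ k * ((1 / 2 : ℝ) ^ (j + 1) * |⟪u, S.f j⟫|) := by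
          refine Finset.sum_le_sum fun j hj ↦ ?_
          rw [← mul_assoc]
          refine le_mul_of_one_le_left (abs_nonneg _) ?_
          refine hpow.symm.trans_le (mul_le_mul_of_nonneg_left ?_ (by positivity))
          exact pow_le_pow_of_le_one (by norm_num : (0 : ℝ) ≤ 1 / 2) (by norm_num)
            (Finset.mem_range.1 hj)
      _ ≤ 2 ^ k * T := by
          rw [← Finset.mul_sum]
          gcongr
          have : 0 ≤ (1 / 2 : ℝ) ^ k * A := by positivity
          linarith
  rcases max_choice A ‖S.Q u‖ with h | h
  · rw [tauNorm, h]
    calc A ^ 2 ≤ (2 ^ k * T) ^ 2 := by gcongr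
      _ ≤ _ := by nlinarith [sq_nonneg T]
  · rw [tauNorm, h, S.norm_Q_sq hk hPk hQk hPQk u]
    have hQT : ‖Qk u‖ ≤ T := le_max_right _ _
    calc _ ≤ (2 ^ k * T) ^ 2 + T ^ 2 := by gcongr
      _ = _ := by ring

end FountainSetup

/-- **Remark 1.1.**  For every `k ≥ 1`, the τ_k-norm and the τ-norm are equivalent;
in particular for `k = 1` one has `‖u‖_τ² ≤ 8 ‖u‖_{τ_1}²` and `‖u‖_{τ_1} ≤ 2^{3/2} ‖u‖_τ`. -/
theorem tauK_norm_equivalent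
    {X : Type*} [NormedAddCommGroup X] [InnerProductSpace ℝ X] [CompleteSpace X]
    (S : FountainSetup X) (k : ℕ) (hk : 1 ≤ k)
    -- P_k, Q_k : the orthogonal projections onto Y_{k-1} and Z_k
    (Pk Qk : X →L[ℝ] X)
    (hPk : ∀ u, Pk u ∈ S.Yk (k - 1)) (hQk : ∀ u, Qk u ∈ S.Zk k)
    (hPQk : ∀ u, Pk u + Qk u = u)
    (horth : ∀ u v : X, ⟪Pk u, Qk v⟫ = 0) :
    -- equivalence of the two norms
    (∃ C₁ : ℝ, 0 < C₁ ∧ ∃ C₂ : ℝ, 0 < C₂ ∧ ∀ u : X,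
      S.tauKNorm k Pk Qk u ≤ C₁ * S.tauNorm u ∧
      S.tauNorm u ≤ C₂ * S.tauKNorm k Pk Qk u) ∧
    -- explicit constants for k = 1
    (k = 1 → ∀ u : X,
      S.tauNorm u ^ 2 ≤ 8 * S.tauKNorm k Pk Qk u ^ 2 ∧
      S.tauKNorm k Pk Qk u ≤ 2 ^ ((3 : ℝ) / 2) * S.tauNorm u) := by
  have hle := S.tauKNorm_le_tauNorm hk hPk hQk hPQk
  have hsq := S.tauNorm_sq_le hk hPk hQk hPQk
  refine ⟨⟨1, one_pos, 2 ^ k + 1, by positivity, fun u ↦ ⟨by simpa using hle u, ?_⟩⟩, ?_⟩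
  · have hT : 0 ≤ S.tauKNorm k Pk Qk u := S.tauKNorm_nonneg u
    refine le_of_sq_le_sq ((hsq u).trans ?_) (by positivity)
    rw [mul_pow]
    gcongr
    nlinarith [pow_pos (two_pos : (0 : ℝ) < 2) k]
  · rintro rfl u
    refine ⟨(hsq u).trans ?_, (hle u).trans ?_⟩
    · gcongr
      norm_num
    · exact le_mul_of_one_le_left (S.tauNorm_nonneg u)
        (Real.one_le_rpow (by norm_num) (by norm_num))

end
end
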